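/- arXiv:2605.10015 — 2 statements merged into one kernel-verified Lean document; each statement's English description precedes it below -/
import Mathlib

section
/- Let p ≥ 1, λ > 0, and suppose k_v ≤ k with k ≥ 1. Let m ∈ ℝ_{≥0}^{k_v} be such that Q_{m,ε} is nonempty, let μ be a probability vector on [k], and set the cost C_{ij} = d(i,j)^p for a metric d. Let ν* ∈ Q_{m,ε} minimize OT(·, μ) over Q_{m,ε}, and let ν^λ ∈ Q_{m,ε} minimize OT_λ(·, μ) over Q_{m,ε}. Then 0 ≤ OT(ν^λ, μ)^{1/p} − OT(ν*, μ)^{1/p} ≤ (2 λ log k)^{1/p}. -/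
open Finset

/-- A probability vector on `Fin n`. -/
def IsProbVec {n : ℕ} (μ : Fin n → ℝ) : Prop :=
  (∀ i, 0 ≤ μ i) ∧ ∑ i, μ i = 1

/-- Discrete optimal transport cost between `ν` (on `Fin kv`) and `μ` (on `Fin k`)
with cost matrix `C`. -/
noncomputable def OT {k kv : ℕ} (C : Fin k → Fin kv → ℝ)
    (ν : Fin kv → ℝ) (μ : Fin k → ℝ) : ℝ :=
  sInf {c | ∃ π : Fin k → Fin kv → ℝ,
    (∀ i j, 0 ≤ π i j) ∧ (∀ i, ∑ j, π i j = μ i) ∧ (∀ j, ∑ i, π i j = ν j) ∧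
    c = ∑ i, ∑ j, C i j * π i j}

/-- The LDP polytope `Q_{m,ε}`. -/
def LDPpolytope {kv : ℕ} (ε : ℝ) (m : Fin kv → ℝ) : Set (Fin kv → ℝ) :=
  {ν | IsProbVec ν ∧ ∀ j, Real.exp (-ε / 2) * m j ≤ ν j ∧ ν j ≤ Real.exp (ε / 2) * m j}


/-- Entropically regularized optimal transport cost (convention `0 · log 0 = 0`). -/
noncomputable def OTent {k kv : ℕ} (lam : ℝ) (C : Fin k → Fin kv → ℝ)
    (ν : Fin kv → ℝ) (μ : Fin k → ℝ) : ℝ :=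
  sInf {c | ∃ π : Fin k → Fin kv → ℝ,
    (∀ i j, 0 ≤ π i j) ∧ (∀ i, ∑ j, π i j = μ i) ∧ (∀ j, ∑ i, π i j = ν j) ∧
    c = ∑ i, ∑ j, C i j * π i j + lam * ∑ i, ∑ j, π i j * Real.log (π i j)}

/-- The couplings of `ν` and `μ`. -/
def couplings {k kv : ℕ} (ν : Fin kv → ℝ) (μ : Fin k → ℝ) : Set (Fin k → Fin kv → ℝ) :=
  {π | (∀ i j, 0 ≤ π i j) ∧ (∀ i, ∑ j, π i j = μ i) ∧ (∀ j, ∑ i, π i j = ν j)}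

theorem couplings_nonempty {k kv : ℕ} {ν : Fin kv → ℝ} {μ : Fin k → ℝ}
    (hν : IsProbVec ν) (hμ : IsProbVec μ) : (couplings ν μ).Nonempty :=
  ⟨fun i j => μ i * ν j, fun i j => mul_nonneg (hμ.1 i) (hν.1 j),
    fun i => by rw [← mul_sum, hν.2, mul_one], fun j => by rw [← sum_mul, hμ.2, one_mul]⟩

theorem sum_couplings {k kv : ℕ} {ν : Fin kv → ℝ} {μ : Fin k → ℝ} (hμ : IsProbVec μ)
    {π : Fin k → Fin kv → ℝ} (hπ : π ∈ couplings ν μ) : ∑ i, ∑ j, π i j = 1 := by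
  simp_rw [hπ.2.1, hμ.2]

theorem sum_mul_log_nonpos {k kv : ℕ} {ν : Fin kv → ℝ} {μ : Fin k → ℝ} (hμ : IsProbVec μ)
    {π : Fin k → Fin kv → ℝ} (hπ : π ∈ couplings ν μ) :
    ∑ i, ∑ j, π i j * Real.log (π i j) ≤ 0 := by
  refine sum_nonpos fun i _ => sum_nonpos fun j _ => ?_
  have h1 : π i j ≤ μ i :=
    (single_le_sum (f := π i) (fun j _ => hπ.1 i j) (mem_univ j)).trans_eq (hπ.2.1 i)
  have h2 : μ i ≤ 1 := (single_le_sum (fun i _ => hμ.1 i) (mem_univ i)).trans_eq hμ.2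
  exact mul_nonpos_of_nonneg_of_nonpos (hπ.1 i j)
    (Real.log_nonpos (hπ.1 i j) (h1.trans h2))

/-- The entropy of a coupling is at most `log (k ^ 2)` when `kv ≤ k`. -/
theorem neg_two_mul_log_le_sum_mul_log {k kv : ℕ} (hk : 1 ≤ k) (hkv : kv ≤ k)
    {ν : Fin kv → ℝ} {μ : Fin k → ℝ} (hμ : IsProbVec μ)
    {π : Fin k → Fin kv → ℝ} (hπ : π ∈ couplings ν μ) :
    -(2 * Real.log k) ≤ ∑ i, ∑ j, π i j * Real.log (π i j) := by
  have hk0 : (0 : ℝ) < k := by exact_mod_cast hk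
  have pointwise : ∀ i j, π i j - 1 / (k : ℝ) ^ 2 - π i j * (2 * Real.log k)
      ≤ π i j * Real.log (π i j) := by
    intro i j
    rcases (hπ.1 i j).eq_or_lt with h | h
    · rw [← h]
      simp
    · have hlog := Real.one_sub_inv_le_log_of_pos (mul_pos h (pow_pos hk0 2))
      rw [Real.log_mul h.ne' (pow_pos hk0 2).ne', Real.log_pow] at hlog
      have := mul_le_mul_of_nonneg_left hlog h.le
      have e : π i j * (1 - (π i j * (k : ℝ) ^ 2)⁻¹) = π i j - 1 / (k : ℝ) ^ 2 := by
        field_simp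
      rw [e] at this
      push_cast at this
      linarith
  have hsum := sum_le_sum fun i (_ : i ∈ univ) => sum_le_sum fun j (_ : j ∈ univ) => pointwise i j
  simp only [sum_sub_distrib, ← sum_mul, sum_couplings hμ hπ, sum_const, card_univ,
    Fintype.card_fin, nsmul_eq_mul] at hsum
  have hle : (k : ℝ) * (kv * (1 / (k : ℝ) ^ 2)) ≤ 1 := by
    have : (kv : ℝ) ≤ k := by exact_mod_cast hkv
    rw [show (k : ℝ) * (kv * (1 / (k : ℝ) ^ 2)) = kv / k by field_simp]
    exact (div_le_one hk0).2 this
  linarith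

theorem sum_cost_nonneg {k kv : ℕ} {C : Fin k → Fin kv → ℝ} (hC : ∀ i j, 0 ≤ C i j)
    {ν : Fin kv → ℝ} {μ : Fin k → ℝ} {π : Fin k → Fin kv → ℝ} (hπ : π ∈ couplings ν μ) :
    0 ≤ ∑ i, ∑ j, C i j * π i j :=
  sum_nonneg fun i _ => sum_nonneg fun j _ => mul_nonneg (hC i j) (hπ.1 i j)

theorem OT_nonneg {k kv : ℕ} {C : Fin k → Fin kv → ℝ} (hC : ∀ i j, 0 ≤ C i j)
    (ν : Fin kv → ℝ) (μ : Fin k → ℝ) : 0 ≤ OT C ν μ := by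
  refine Real.sInf_nonneg ?_
  rintro c ⟨π, h0, h1, h2, rfl⟩
  exact sum_cost_nonneg hC ⟨h0, h1, h2⟩

theorem OT_le {k kv : ℕ} {C : Fin k → Fin kv → ℝ} (hC : ∀ i j, 0 ≤ C i j)
    {ν : Fin kv → ℝ} {μ : Fin k → ℝ} {π : Fin k → Fin kv → ℝ} (hπ : π ∈ couplings ν μ) :
    OT C ν μ ≤ ∑ i, ∑ j, C i j * π i j := by
  refine csInf_le ⟨0, ?_⟩ ⟨π, hπ.1, hπ.2.1, hπ.2.2, rfl⟩
  rintro c ⟨π, h0, h1, h2, rfl⟩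
  exact sum_cost_nonneg hC ⟨h0, h1, h2⟩

theorem OT_le_OTent_add {k kv : ℕ} (hk : 1 ≤ k) (hkv : kv ≤ k) {lam : ℝ} (hlam : 0 ≤ lam)
    {C : Fin k → Fin kv → ℝ} (hC : ∀ i j, 0 ≤ C i j)
    {ν : Fin kv → ℝ} {μ : Fin k → ℝ} (hν : IsProbVec ν) (hμ : IsProbVec μ) :
    OT C ν μ ≤ OTent lam C ν μ + 2 * lam * Real.log k := by
  rw [← sub_le_iff_le_add]
  obtain ⟨π₀, hπ₀⟩ := couplings_nonempty hν hμ
  refine le_csInf ⟨_, π₀, hπ₀.1, hπ₀.2.1, hπ₀.2.2, rfl⟩ ?_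
  rintro c ⟨π, h0, h1, h2, rfl⟩
  have hπ : π ∈ couplings ν μ := ⟨h0, h1, h2⟩
  have := mul_le_mul_of_nonneg_left (neg_two_mul_log_le_sum_mul_log hk hkv hμ hπ) hlam
  linarith [OT_le hC hπ]

theorem OTent_le_OT {k kv : ℕ} (hk : 1 ≤ k) (hkv : kv ≤ k) {lam : ℝ} (hlam : 0 ≤ lam)
    {C : Fin k → Fin kv → ℝ} (hC : ∀ i j, 0 ≤ C i j)
    {ν : Fin kv → ℝ} {μ : Fin k → ℝ} (hν : IsProbVec ν) (hμ : IsProbVec μ) :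
    OTent lam C ν μ ≤ OT C ν μ := by
  obtain ⟨π₀, hπ₀⟩ := couplings_nonempty hν hμ
  refine le_csInf ⟨_, π₀, hπ₀.1, hπ₀.2.1, hπ₀.2.2, rfl⟩ ?_
  rintro c ⟨π, h0, h1, h2, rfl⟩
  have hπ : π ∈ couplings ν μ := ⟨h0, h1, h2⟩
  have hbdd : BddBelow {c | ∃ π : Fin k → Fin kv → ℝ,
      (∀ i j, 0 ≤ π i j) ∧ (∀ i, ∑ j, π i j = μ i) ∧ (∀ j, ∑ i, π i j = ν j) ∧
      c = ∑ i, ∑ j, C i j * π i j + lam * ∑ i, ∑ j, π i j * Real.log (π i j)} := by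
    refine ⟨lam * -(2 * Real.log k), ?_⟩
    rintro c ⟨π, h0, h1, h2, rfl⟩
    have hπ : π ∈ couplings ν μ := ⟨h0, h1, h2⟩
    have := mul_le_mul_of_nonneg_left (neg_two_mul_log_le_sum_mul_log hk hkv hμ hπ) hlam
    linarith [sum_cost_nonneg hC hπ]
  have hle := csInf_le hbdd ⟨π, h0, h1, h2, rfl⟩
  have := mul_nonpos_of_nonneg_of_nonpos hlam (sum_mul_log_nonpos hμ hπ)
  unfold OTent
  linarith

/-- Entropic approximation error of the Wasserstein projection:
`0 ≤ W_p(ν^λ, μ) − W_p(ν*, μ) ≤ (2 λ log k)^{1/p}`, where `W_p = OT^{1/p}` and the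
cost is `C_{ij} = d(i,j)^p` for a metric `d` (with `[k_v] ⊆ [k]`). -/
theorem entropic_projection_gap {k kv : ℕ} (hk : 1 ≤ k) (hkv : kv ≤ k)
    (ε : ℝ) (hε : 0 < ε) (p : ℝ) (hp : 1 ≤ p) (lam : ℝ) (hlam : 0 < lam)
    (d : Fin k → Fin k → ℝ)
    (hd_nonneg : ∀ i j, 0 ≤ d i j)
    (hd_self : ∀ i, d i i = 0)
    (hd_symm : ∀ i j, d i j = d j i)
    (hd_triangle : ∀ i j l, d i l ≤ d i j + d j l)
    (C : Fin k → Fin kv → ℝ)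
    (hC : ∀ i j, C i j = d i (Fin.castLE hkv j) ^ p)
    (m : Fin kv → ℝ) (hm : ∀ j, 0 ≤ m j)
    (hQ : (LDPpolytope ε m).Nonempty)
    (μ : Fin k → ℝ) (hμ : IsProbVec μ)
    (νstar : Fin kv → ℝ)
    (hνstar : νstar ∈ LDPpolytope ε m ∧
      ∀ ν ∈ LDPpolytope ε m, OT C νstar μ ≤ OT C ν μ)
    (νlam : Fin kv → ℝ)
    (hνlam : νlam ∈ LDPpolytope ε m ∧
      ∀ ν ∈ LDPpolytope ε m, OTent lam C νlam μ ≤ OTent lam C ν μ) :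
    0 ≤ OT C νlam μ ^ (1 / p) - OT C νstar μ ^ (1 / p) ∧
      OT C νlam μ ^ (1 / p) - OT C νstar μ ^ (1 / p) ≤
        (2 * lam * Real.log (k : ℝ)) ^ (1 / p) := by
  have hC0 : ∀ i j, 0 ≤ C i j := fun i j => hC i j ▸ Real.rpow_nonneg (hd_nonneg _ _) p
  have hp0 : 0 < p := zero_lt_one.trans_le hp
  have hinv : 0 ≤ 1 / p := (one_div_pos.2 hp0).le
  have hinv1 : 1 / p ≤ 1 := (div_le_one hp0).2 hp
  have hlog : 0 ≤ 2 * lam * Real.log (k : ℝ) :=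
    mul_nonneg (by positivity) (Real.log_natCast_nonneg k)
  have hstar0 := OT_nonneg hC0 νstar μ
  have hgap : OT C νlam μ ≤ OT C νstar μ + 2 * lam * Real.log k := by
    linarith [OT_le_OTent_add hk hkv hlam.le hC0 hνlam.1.1 hμ, hνlam.2 νstar hνstar.1,
      OTent_le_OT hk hkv hlam.le hC0 hνstar.1.1 hμ]
  refine ⟨sub_nonneg.2 (Real.rpow_le_rpow hstar0 (hνstar.2 νlam hνlam.1) hinv), ?_⟩
  rw [sub_le_iff_le_add']
  exact (Real.rpow_le_rpow (OT_nonneg hC0 νlam μ) hgap hinv).trans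
    (Real.rpow_add_le_add_rpow hstar0 hlog hinv hinv1)
end

section
/- Let K ∈ ℝ_{>0}^{k × k_v} be an entrywise positive matrix, μ ∈ ℝ_{>0}^{k} an entrywise positive probability vector, and m ∈ ℝ_{>0}^{k_v} entrywise positive with Q_{m,ε} nonempty. Let Π(s) denote the unique minimizer of KL(q ∥ s) over q ∈ Q_{m,ε}, and define T : ℝ_{>0}^{k_v} → ℝ_{>0}^{k_v} by T(v) := Π( Kᵀ(μ/(Kv)) ) / ( Kᵀ(μ/(Kv)) ), where divisions and quotients are componentwise. For a positive matrix A, let τ(A) := sup { d_H(Ax, Ay) / d_H(x, y) : x, y entrywise positive, x not a positive scalar multiple of y }. Then for all v, w ∈ ℝ_{>0}^{k_v}, d_H(T(v), T(w)) ≤ τ(Kᵀ) · τ(K) · d_H(v, w). -/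
open Finset

/-- Hilbert projective metric on positive vectors. -/
noncomputable def hilbertDist {n : ℕ} (x y : Fin n → ℝ) : ℝ :=
  Real.log ((⨆ i, x i / y i) / (⨅ i, x i / y i))

/-- Vector KL divergence `Σ_j q_j log(q_j/x_j)` (convention `0 · log 0 = 0`). -/
noncomputable def KLvec {n : ℕ} (q x : Fin n → ℝ) : ℝ :=
  ∑ j, q j * Real.log (q j / x j)

/-- Birkhoff contraction coefficient of a positive matrix: the best Lipschitz constant
of `x ↦ Ax` on positive vectors with respect to the Hilbert projective metric. -/
noncomputable def birkhoffCoeff {a b : ℕ} (A : Fin a → Fin b → ℝ) : ℝ :=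
  sSup {r | ∃ x y : Fin b → ℝ, (∀ j, 0 < x j) ∧ (∀ j, 0 < y j) ∧
    (¬ ∃ c : ℝ, 0 < c ∧ x = c • y) ∧
    r = hilbertDist (fun i => ∑ j, A i j * x j) (fun i => ∑ j, A i j * y j) /
        hilbertDist x y}

section HilbertMetric

variable {n : ℕ}

theorem iInf_ratio_le (x y : Fin n → ℝ) (i : Fin n) : ⨅ i, x i / y i ≤ x i / y i :=
  ciInf_le (Set.finite_range _).bddBelow i

theorem ratio_le_iSup (x y : Fin n → ℝ) (i : Fin n) : x i / y i ≤ ⨆ i, x i / y i :=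
  le_ciSup (f := fun i => x i / y i) (Set.finite_range _).bddAbove i

theorem iInf_ratio_pos [Nonempty (Fin n)] {x y : Fin n → ℝ} (hx : ∀ i, 0 < x i)
    (hy : ∀ i, 0 < y i) : 0 < ⨅ i, x i / y i := by
  obtain ⟨i, hi⟩ := exists_eq_ciInf_of_finite (f := fun i => x i / y i)
  rw [← hi]
  exact div_pos (hx i) (hy i)

theorem iSup_ratio_pos [Nonempty (Fin n)] {x y : Fin n → ℝ} (hx : ∀ i, 0 < x i)
    (hy : ∀ i, 0 < y i) : 0 < ⨆ i, x i / y i :=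
  let i := Classical.arbitrary (Fin n)
  (div_pos (hx i) (hy i)).trans_le (ratio_le_iSup x y i)

theorem iInf_ratio_mul_le {x y : Fin n → ℝ} (hy : ∀ i, 0 < y i) (i : Fin n) :
    (⨅ i, x i / y i) * y i ≤ x i :=
  (le_div_iff₀ (hy i)).1 (iInf_ratio_le x y i)

theorem le_iSup_ratio_mul {x y : Fin n → ℝ} (hy : ∀ i, 0 < y i) (i : Fin n) :
    x i ≤ (⨆ i, x i / y i) * y i :=
  (div_le_iff₀ (hy i)).1 (ratio_le_iSup x y i)

theorem hilbertDist_le_log [Nonempty (Fin n)] {x y : Fin n → ℝ} (hx : ∀ i, 0 < x i)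
    (hy : ∀ i, 0 < y i) {a b : ℝ} (ha : 0 < a) (hax : ∀ i, a * y i ≤ x i)
    (hxb : ∀ i, x i ≤ b * y i) : hilbertDist x y ≤ Real.log (b / a) := by
  have hinf : a ≤ ⨅ i, x i / y i := le_ciInf fun i => (le_div_iff₀ (hy i)).2 (hax i)
  have hsup : ⨆ i, x i / y i ≤ b := ciSup_le fun i => (div_le_iff₀ (hy i)).2 (hxb i)
  have hpos := iSup_ratio_pos hx hy
  exact Real.log_le_log (div_pos hpos (iInf_ratio_pos hx hy))
    (div_le_div₀ (hpos.le.trans hsup) hsup ha hinf)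

theorem hilbertDist_nonneg [Nonempty (Fin n)] {x y : Fin n → ℝ} (hx : ∀ i, 0 < x i)
    (hy : ∀ i, 0 < y i) : 0 ≤ hilbertDist x y := by
  let i := Classical.arbitrary (Fin n)
  exact Real.log_nonneg ((one_le_div (iInf_ratio_pos hx hy)).2
    ((iInf_ratio_le x y i).trans (ratio_le_iSup x y i)))

/-- If reciprocal bounds hold for the ratios `x' / y'`, then `x'`, `y'` are at least as close as
`x`, `y`. -/
theorem hilbertDist_le_of_inv_bounds {p : ℕ} [Nonempty (Fin n)] [Nonempty (Fin p)]
    {x y : Fin n → ℝ} {x' y' : Fin p → ℝ} (hx : ∀ i, 0 < x i) (hy : ∀ i, 0 < y i)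
    (hx' : ∀ i, 0 < x' i) (hy' : ∀ i, 0 < y' i)
    (hlo : ∀ i, y' i ≤ (⨆ i, x i / y i) * x' i) (hhi : ∀ i, (⨅ i, x i / y i) * x' i ≤ y' i) :
    hilbertDist x' y' ≤ hilbertDist x y := by
  have hA := iInf_ratio_pos hx hy
  have hB := iSup_ratio_pos hx hy
  refine (hilbertDist_le_log hx' hy' (inv_pos.2 hB) (b := (⨅ i, x i / y i)⁻¹)
    (fun i => (inv_mul_le_iff₀ hB).2 (hlo i)) fun i => (le_inv_mul_iff₀ hA).2 (hhi i)).trans_eq ?_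
  rw [hilbertDist, inv_div_inv]

theorem hilbertDist_div_le [Nonempty (Fin n)] {μ x y : Fin n → ℝ} (hμ : ∀ i, 0 < μ i)
    (hx : ∀ i, 0 < x i) (hy : ∀ i, 0 < y i) :
    hilbertDist (fun i => μ i / x i) (fun i => μ i / y i) ≤ hilbertDist x y := by
  refine hilbertDist_le_of_inv_bounds hx hy (fun i => div_pos (hμ i) (hx i))
    (fun i => div_pos (hμ i) (hy i)) (fun i => ?_) fun i => ?_
  · rw [mul_div_assoc', div_le_div_iff₀ (hy i) (hx i)]
    nlinarith [mul_le_mul_of_nonneg_left (le_iSup_ratio_mul (x := x) hy i) (hμ i).le]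
  · rw [mul_div_assoc', div_le_div_iff₀ (hx i) (hy i)]
    nlinarith [mul_le_mul_of_nonneg_left (iInf_ratio_mul_le (x := x) hy i) (hμ i).le]

theorem hilbertDist_smul_self [Nonempty (Fin n)] {y : Fin n → ℝ} (hy : ∀ i, 0 < y i) {c : ℝ}
    (hc : 0 < c) : hilbertDist (c • y) y = 0 := by
  have h : ∀ i, (c • y) i / y i = c := fun i => mul_div_cancel_right₀ c (hy i).ne'
  simp only [hilbertDist, h, ciInf_const, ciSup_const, div_self hc.ne', Real.log_one]

end HilbertMetric

section Birkhoff

variable {a b : ℕ} [Nonempty (Fin b)] {A : Fin a → Fin b → ℝ}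

theorem sum_mul_pos_of_pos (hA : ∀ i j, 0 < A i j) {x : Fin b → ℝ} (hx : ∀ j, 0 < x j)
    (i : Fin a) : 0 < ∑ j, A i j * x j :=
  sum_pos (fun j _ => mul_pos (hA i j) (hx j)) univ_nonempty

theorem hilbertDist_mulVec_le [Nonempty (Fin a)] (hA : ∀ i j, 0 < A i j) {x y : Fin b → ℝ} (hx : ∀ j, 0 < x j)
    (hy : ∀ j, 0 < y j) :
    hilbertDist (fun i => ∑ j, A i j * x j) (fun i => ∑ j, A i j * y j) ≤ hilbertDist x y := by
  refine hilbertDist_le_log (sum_mul_pos_of_pos hA hx) (sum_mul_pos_of_pos hA hy)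
    (iInf_ratio_pos hx hy) (fun i => ?_) fun i => ?_
  · rw [mul_sum]
    refine sum_le_sum fun j _ => ?_
    nlinarith [mul_le_mul_of_nonneg_left (iInf_ratio_mul_le (x := x) hy j) (hA i j).le]
  · rw [mul_sum]
    refine sum_le_sum fun j _ => ?_
    nlinarith [mul_le_mul_of_nonneg_left (le_iSup_ratio_mul (x := x) hy j) (hA i j).le]

theorem birkhoffCoeff_nonneg [Nonempty (Fin a)] (hA : ∀ i j, 0 < A i j) : 0 ≤ birkhoffCoeff A := by
  refine Real.sSup_nonneg ?_
  rintro _ ⟨x, y, hx, hy, -, rfl⟩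
  exact div_nonneg (hilbertDist_nonneg (sum_mul_pos_of_pos hA hx) (sum_mul_pos_of_pos hA hy))
    (hilbertDist_nonneg hx hy)

theorem hilbertDist_mulVec_le_birkhoffCoeff_mul [Nonempty (Fin a)] (hA : ∀ i j, 0 < A i j) {x y : Fin b → ℝ}
    (hx : ∀ j, 0 < x j) (hy : ∀ j, 0 < y j) :
    hilbertDist (fun i => ∑ j, A i j * x j) (fun i => ∑ j, A i j * y j) ≤
      birkhoffCoeff A * hilbertDist x y := by
  have hle := hilbertDist_mulVec_le hA hx hy
  rcases (hilbertDist_nonneg hx hy).eq_or_lt with h0 | hpos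
  · simpa [← h0] using hle
  · rw [← div_le_iff₀ hpos]
    refine le_csSup ⟨1, ?_⟩ ⟨x, y, hx, hy, ?_, rfl⟩
    · rintro _ ⟨x', y', hx', hy', -, rfl⟩
      exact div_le_one_of_le₀ (hilbertDist_mulVec_le hA hx' hy') (hilbertDist_nonneg hx' hy')
    · rintro ⟨c, hc, rfl⟩
      exact hpos.ne' (hilbertDist_smul_self hy hc)

end Birkhoff

section Projection

theorem mul_log_div_sub_le {x y s : ℝ} (hx : 0 < x) (hy : 0 < y) (hs : 0 < s) :
    x * Real.log (x / s) - y * Real.log (y / s) ≤ (x - y) * (Real.log (x / s) + 1) := by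
  have h := Real.log_le_sub_one_of_pos (div_pos hx hy)
  have h2 := mul_le_mul_of_nonneg_left h hy.le
  rw [mul_sub, mul_div_cancel₀ _ hy.ne', Real.log_div hx.ne' hy.ne'] at h2
  rw [Real.log_div hx.ne' hs.ne', Real.log_div hy.ne' hs.ne']
  linarith

variable {n : ℕ} {ε : ℝ} {m s q : Fin n → ℝ}

theorem LDPpolytope.pos (hm : ∀ j, 0 < m j) (hq : q ∈ LDPpolytope ε m) (j : Fin n) : 0 < q j :=
  (mul_pos (Real.exp_pos _) (hm j)).trans_le (hq.2 j).1

/-- Mass cannot profitably be moved from `i` to `j` at a KL minimizer. -/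
theorem ratio_le_ratio_of_isMinOn (hm : ∀ j, 0 < m j) (hs : ∀ j, 0 < s j)
    (hq : q ∈ LDPpolytope ε m) (hmin : ∀ p ∈ LDPpolytope ε m, KLvec q s ≤ KLvec p s)
    {i j : Fin n} (hi : Real.exp (-ε / 2) * m i < q i) (hj : q j < Real.exp (ε / 2) * m j) :
    q i / s i ≤ q j / s j := by
  rcases eq_or_ne i j with rfl | hij
  · exact le_rfl
  by_contra! hlt
  set t₀ := min (q i - Real.exp (-ε / 2) * m i) (Real.exp (ε / 2) * m j - q j)
  have ht₀pos : 0 < t₀ := lt_min (sub_pos.2 hi) (sub_pos.2 hj)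
  have hc : 0 < 1 / s i + 1 / s j := add_pos (one_div_pos.2 (hs i)) (one_div_pos.2 (hs j))
  obtain ⟨t, htpos, htt₀, htsmall⟩ : ∃ t, 0 < t ∧ t ≤ t₀ ∧
      t * (1 / s i + 1 / s j) < q i / s i - q j / s j := by
    have hδ : 0 < (q i / s i - q j / s j) / (1 / s i + 1 / s j) := div_pos (sub_pos.2 hlt) hc
    refine ⟨min t₀ ((q i / s i - q j / s j) / (1 / s i + 1 / s j) / 2),
      lt_min ht₀pos (half_pos hδ), min_le_left _ _, ?_⟩
    rw [← lt_div_iff₀ hc]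
    exact (min_le_right _ _).trans_lt (half_lt_self hδ)
  have hti : t ≤ q i - Real.exp (-ε / 2) * m i := htt₀.trans (min_le_left _ _)
  have htj : t ≤ Real.exp (ε / 2) * m j - q j := htt₀.trans (min_le_right _ _)
  let p : Fin n → ℝ := Function.update (Function.update q i (q i - t)) j (q j + t)
  have hpi : p i = q i - t := by simp [p, hij]
  have hpj : p j = q j + t := by simp [p]
  have hpl : ∀ l, l ≠ i → l ≠ j → p l = q l := fun l h₁ h₂ => by simp [p, h₁, h₂]
  have hsplit : ∀ f : Fin n → ℝ, (∀ l, l ≠ i → l ≠ j → f l = 0) → ∑ l, f l = f i + f j :=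
    fun f hf => Fintype.sum_eq_add i j hij fun l hl => hf l hl.1 hl.2
  have hbounds : ∀ l, Real.exp (-ε / 2) * m l ≤ p l ∧ p l ≤ Real.exp (ε / 2) * m l := by
    intro l
    have hl := hq.2 l
    by_cases h₁ : l = i
    · subst h₁; rw [hpi]; constructor <;> linarith
    by_cases h₂ : l = j
    · subst h₂; rw [hpj]; constructor <;> linarith
    rwa [hpl l h₁ h₂]
  have hsum : ∑ l, p l = 1 := by
    have h := hsplit (fun l => p l - q l) fun l h₁ h₂ => by simp [hpl l h₁ h₂]
    rw [sum_sub_distrib, hq.1.2, hpi, hpj] at h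
    linarith
  have hp : p ∈ LDPpolytope ε m :=
    ⟨⟨fun l => (mul_pos (Real.exp_pos _) (hm l)).le.trans (hbounds l).1, hsum⟩, hbounds⟩
  have hKL := hmin p hp
  have hdiff := hsplit (fun l => p l * Real.log (p l / s l) - q l * Real.log (q l / s l))
    fun l h₁ h₂ => by simp [hpl l h₁ h₂]
  have hqpos := LDPpolytope.pos hm hq
  have hppos := LDPpolytope.pos hm hp
  have hbi := mul_log_div_sub_le (hppos i) (hqpos i) (hs i)
  have hbj := mul_log_div_sub_le (hppos j) (hqpos j) (hs j)
  rw [sum_sub_distrib] at hdiff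
  simp only [KLvec] at hKL
  have hprod : 0 ≤ t * (Real.log (p j / s j) - Real.log (p i / s i)) := by
    have h₁ : p i - q i = -t := by rw [hpi]; ring
    have h₂ : p j - q j = t := by rw [hpj]; ring
    rw [h₁] at hbi
    rw [h₂] at hbj
    linarith
  have hlog : Real.log (p i / s i) ≤ Real.log (p j / s j) :=
    sub_nonneg.1 (nonneg_of_mul_nonneg_right hprod htpos)
  have hle := (Real.log_le_log_iff (div_pos (hppos i) (hs i)) (div_pos (hppos j) (hs j))).1 hlog
  rw [hpi, hpj, sub_div, add_div] at hle
  rw [mul_add, mul_one_div, mul_one_div] at htsmall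
  linarith

/-- The map `s ↦ Π(s) / s` reverses domination up to the scaling factor. -/
theorem minimizer_ratio_le {s' q' : Fin n → ℝ} (hm : ∀ j, 0 < m j) (hs : ∀ j, 0 < s j)
    (hs' : ∀ j, 0 < s' j) (hq : q ∈ LDPpolytope ε m)
    (hmin : ∀ p ∈ LDPpolytope ε m, KLvec q s ≤ KLvec p s) (hq' : q' ∈ LDPpolytope ε m)
    (hmin' : ∀ p ∈ LDPpolytope ε m, KLvec q' s' ≤ KLvec p s') {c : ℝ} (hc : 0 < c)
    (hss' : ∀ j, s' j ≤ c * s j) (j : Fin n) : q j / s j ≤ c * (q' j / s' j) := by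
  have key : ∀ l, c * (q' l / s' l) < q l / s l → q' l < q l := by
    intro l hl
    by_contra! hle
    refine hl.not_ge ?_
    rw [mul_div_assoc', div_le_div_iff₀ (hs l) (hs' l)]
    have h₁ := mul_le_mul hle (hss' l) (hs' l).le (LDPpolytope.pos hm hq' l).le
    linarith
  by_contra! hlt
  have hj := key j hlt
  obtain ⟨i, hi⟩ : ∃ i, q i < q' i := by
    by_contra! h
    have := sum_lt_sum (fun l _ => h l) ⟨j, mem_univ j, hj⟩
    rw [hq.1.2, hq'.1.2] at this
    exact lt_irrefl _ this
  have h₁ : q j / s j ≤ q i / s i := ratio_le_ratio_of_isMinOn hm hs hq hmin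
    ((hq'.2 j).1.trans_lt hj) (hi.trans_le (hq'.2 i).2)
  have h₂ : q' i / s' i ≤ q' j / s' j := ratio_le_ratio_of_isMinOn hm hs' hq' hmin'
    ((hq.2 i).1.trans_lt hi) (hj.trans_le (hq.2 j).2)
  exact hi.not_gt (key i (((mul_le_mul_of_nonneg_left h₂ hc.le).trans_lt hlt).trans_le h₁))

theorem hilbertDist_minimizer_ratio_le [Nonempty (Fin n)] {s' q' : Fin n → ℝ}
    (hm : ∀ j, 0 < m j) (hs : ∀ j, 0 < s j) (hs' : ∀ j, 0 < s' j) (hq : q ∈ LDPpolytope ε m)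
    (hmin : ∀ p ∈ LDPpolytope ε m, KLvec q s ≤ KLvec p s) (hq' : q' ∈ LDPpolytope ε m)
    (hmin' : ∀ p ∈ LDPpolytope ε m, KLvec q' s' ≤ KLvec p s') :
    hilbertDist (fun j => q j / s j) (fun j => q' j / s' j) ≤ hilbertDist s s' := by
  have hA := iInf_ratio_pos hs hs'
  refine hilbertDist_le_of_inv_bounds hs hs' (fun j => div_pos (LDPpolytope.pos hm hq j) (hs j))
    (fun j => div_pos (LDPpolytope.pos hm hq' j) (hs' j)) (fun j => ?_) fun j => ?_
  · exact minimizer_ratio_le hm hs' hs hq' hmin' hq hmin (iSup_ratio_pos hs hs')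
      (le_iSup_ratio_mul hs') j
  · rw [← le_inv_mul_iff₀ hA]
    exact minimizer_ratio_le hm hs hs' hq hmin hq' hmin' (inv_pos.2 hA)
      (fun l => (le_inv_mul_iff₀ hA).2 (iInf_ratio_mul_le hs' l)) j

end Projection

/-- The Sinkhorn-type composite map
`T(v) = Π(Kᵀ(μ/(Kv))) / (Kᵀ(μ/(Kv)))` contracts the Hilbert projective metric
with factor `τ(Kᵀ)·τ(K)`. -/
theorem composite_map_contraction {k kv : ℕ} (ε : ℝ) (hε : 0 < ε)
    (K : Fin k → Fin kv → ℝ) (hK : ∀ i j, 0 < K i j)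
    (μ : Fin k → ℝ) (hμ : ∀ i, 0 < μ i) (hμ1 : ∑ i, μ i = 1)
    (m : Fin kv → ℝ) (hm : ∀ j, 0 < m j)
    (hQ : (LDPpolytope ε m).Nonempty)
    (Pi : (Fin kv → ℝ) → (Fin kv → ℝ))
    (hPi : ∀ s, (∀ j, 0 < s j) →
      Pi s ∈ LDPpolytope ε m ∧ ∀ q ∈ LDPpolytope ε m, KLvec (Pi s) s ≤ KLvec q s)
    (s : (Fin kv → ℝ) → (Fin kv → ℝ))
    (hs : ∀ v, s v = fun j => ∑ i, K i j * (μ i / ∑ j', K i j' * v j'))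
    (T : (Fin kv → ℝ) → (Fin kv → ℝ))
    (hT : ∀ v, T v = fun j => Pi (s v) j / s v j) :
    ∀ v w : Fin kv → ℝ, (∀ j, 0 < v j) → (∀ j, 0 < w j) →
      hilbertDist (T v) (T w) ≤
        birkhoffCoeff (fun j i => K i j) * birkhoffCoeff K * hilbertDist v w := by
  intro v w hv hw
  have : Nonempty (Fin k) := by
    by_contra h
    rw [not_nonempty_iff] at h
    simp at hμ1
  have : Nonempty (Fin kv) := by
    by_contra h
    rw [not_nonempty_iff] at h
    obtain ⟨q, hq⟩ := hQ
    simpa using hq.1.2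
  have hKt : ∀ j i, 0 < (fun j i => K i j : Fin kv → Fin k → ℝ) j i := fun j i => hK i j
  have hKv := sum_mul_pos_of_pos hK hv
  have hKw := sum_mul_pos_of_pos hK hw
  have hμv : ∀ i, 0 < μ i / ∑ j, K i j * v j := fun i => div_pos (hμ i) (hKv i)
  have hμw : ∀ i, 0 < μ i / ∑ j, K i j * w j := fun i => div_pos (hμ i) (hKw i)
  have hsv : ∀ j, 0 < s v j := by rw [hs]; exact sum_mul_pos_of_pos hKt hμv
  have hsw : ∀ j, 0 < s w j := by rw [hs]; exact sum_mul_pos_of_pos hKt hμw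
  obtain ⟨hv₁, hv₂⟩ := hPi _ hsv
  obtain ⟨hw₁, hw₂⟩ := hPi _ hsw
  calc hilbertDist (T v) (T w) ≤ hilbertDist (s v) (s w) := by
        rw [hT, hT]
        exact hilbertDist_minimizer_ratio_le hm hsv hsw hv₁ hv₂ hw₁ hw₂
    _ ≤ birkhoffCoeff (fun j i => K i j) * hilbertDist (fun i => μ i / ∑ j, K i j * v j)
          (fun i => μ i / ∑ j, K i j * w j) := by
        rw [hs, hs]
        exact hilbertDist_mulVec_le_birkhoffCoeff_mul hKt hμv hμw
    _ ≤ birkhoffCoeff (fun j i => K i j) * (birkhoffCoeff K * hilbertDist v w) :=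
        mul_le_mul_of_nonneg_left ((hilbertDist_div_le hμ hKv hKw).trans
          (hilbertDist_mulVec_le_birkhoffCoeff_mul hK hv hw)) (birkhoffCoeff_nonneg hKt)
    _ = birkhoffCoeff (fun j i => K i j) * birkhoffCoeff K * hilbertDist v w :=
        (mul_assoc _ _ _).symm
end
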